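/- Let n ≥ 1, let d be a real symmetric n×n matrix with zero diagonal, let m be a natural number with 1 ≤ m ≤ n, and let P be a real penalty coefficient with P > 2·∑_{i≠j} |d_{ij}|. Define the penalized objective f(x) = ∑_{i≠j} d_{ij} x_i x_j − P·(∑_{i=1}^n x_i − m)² for x ∈ {0,1}ⁿ. Then: (1) every maximizer x* of f over {0,1}ⁿ satisfies the cardinality constraint ∑_i x*_i = m; and (2) the maximum of f over {0,1}ⁿ equals the maximum of ∑_{i≠j} d_{ij} x_i x_j over all x ∈ {0,1}ⁿ satisfying ∑_i x_i = m. -/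

import Mathlib

open Matrix BigOperators

/-- QUBO penalty reformulation of the Maximum Diversity Problem: with a
sufficiently large penalty `P`, (1) every maximizer of the penalized objective
over binary vectors satisfies the cardinality constraint `∑ i, x i = m`, and
(2) the penalized maximum equals the constrained maximum of the diversity
objective. -/
theorem mdp_qubo_penalty {n : ℕ} (hn : 1 ≤ n)
    (d : Matrix (Fin n) (Fin n) ℝ) (hd : dᵀ = d) (hdiag : ∀ i, d i i = 0)
    (m : ℕ) (hm1 : 1 ≤ m) (hmn : m ≤ n)
    (P : ℝ) (hP : P > 2 * ∑ i, ∑ j, if i ≠ j then |d i j| else 0) :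
    (∀ x : Fin n → ℝ, (∀ j, x j = 0 ∨ x j = 1) →
      (∀ y : Fin n → ℝ, (∀ j, y j = 0 ∨ y j = 1) →
        (∑ i, ∑ j, if i ≠ j then d i j * y i * y j else 0)
            - P * ((∑ i, y i) - m) ^ 2 ≤
          (∑ i, ∑ j, if i ≠ j then d i j * x i * x j else 0)
            - P * ((∑ i, x i) - m) ^ 2) →
      (∑ i, x i) = m) ∧
    (∀ v : ℝ,
      IsGreatest ((fun x : Fin n → ℝ =>
          (∑ i, ∑ j, if i ≠ j then d i j * x i * x j else 0)
            - P * ((∑ i, x i) - m) ^ 2) ''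
        {x : Fin n → ℝ | ∀ j, x j = 0 ∨ x j = 1}) v ↔
      IsGreatest ((fun x : Fin n → ℝ =>
          ∑ i, ∑ j, if i ≠ j then d i j * x i * x j else 0) ''
        {x : Fin n → ℝ | (∀ j, x j = 0 ∨ x j = 1) ∧ (∑ i, x i) = m}) v) := by
  set S : ℝ := ∑ i, ∑ j, if i ≠ j then |d i j| else 0 with hS
  obtain ⟨Q, hQ⟩ : ∃ Q : (Fin n → ℝ) → ℝ,
      ∀ x, (∑ i, ∑ j, if i ≠ j then d i j * x i * x j else 0) = Q x := ⟨_, fun _ => rfl⟩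
  have hS0 : 0 ≤ S := by
    refine Finset.sum_nonneg fun i _ => Finset.sum_nonneg fun j _ => ?_
    split_ifs <;> positivity
  have hB : ∀ x : Fin n → ℝ, (∀ j, x j = 0 ∨ x j = 1) → |Q x| ≤ S := by
    intro x hx
    rw [← hQ]
    refine (Finset.abs_sum_le_sum_abs _ _).trans (Finset.sum_le_sum fun i _ => ?_)
    refine (Finset.abs_sum_le_sum_abs _ _).trans (Finset.sum_le_sum fun j _ => ?_)
    split_ifs
    · rcases hx i with h | h <;> rcases hx j with h' | h' <;> simp [h, h']
    · simp
  have hint : ∀ x : Fin n → ℝ, (∀ j, x j = 0 ∨ x j = 1) → ∃ k : ℤ, (∑ i, x i) = k := by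
    intro x hx
    have : ∀ j, ∃ k : ℤ, x j = k := by
      intro j
      rcases hx j with h | h
      · exact ⟨0, by simp [h]⟩
      · exact ⟨1, by simp [h]⟩
    choose k hk using this
    exact ⟨∑ i, k i, by simp [hk]⟩
  have hkey : ∀ x y : Fin n → ℝ, (∀ j, x j = 0 ∨ x j = 1) → (∀ j, y j = 0 ∨ y j = 1) →
      (∑ i, x i) ≠ m → Q x - P * ((∑ i, x i) - m) ^ 2 < Q y := by
    intro x y hx hy hne
    obtain ⟨k, hk⟩ := hint x hx
    have h1 : (1 : ℝ) ≤ ((∑ i, x i) - m) ^ 2 := by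
      rw [hk] at hne ⊢
      have h0 : k - (m : ℤ) ≠ 0 := by
        intro h
        apply hne
        have : k = (m : ℤ) := by omega
        simp [this]
      have h2 : 0 < (k - (m : ℤ)) ^ 2 := by positivity
      have h3 : 1 ≤ (k - (m : ℤ)) ^ 2 := h2
      exact_mod_cast h3
    have hx1 := abs_le.mp (hB x hx)
    have hy1 := abs_le.mp (hB y hy)
    nlinarith
  obtain ⟨z, hz, hzm⟩ : ∃ z : Fin n → ℝ, (∀ j, z j = 0 ∨ z j = 1) ∧ (∑ i, z i) = m := by
    obtain ⟨t, -, ht⟩ := Finset.exists_subset_card_eq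
      (s := (Finset.univ : Finset (Fin n))) (n := m) (by simpa using hmn)
    refine ⟨fun j => if j ∈ t then 1 else 0, fun j => ?_, ?_⟩
    · by_cases h : j ∈ t <;> simp [h]
    · simp [ht]
  simp only [hQ]
  have hfe : ∀ x : Fin n → ℝ, (∑ i, x i) = m → Q x - P * ((∑ i, x i) - m) ^ 2 = Q x := by
    intro x h
    simp [h]
  have hone : ∀ x : Fin n → ℝ, (∀ j, x j = 0 ∨ x j = 1) →
      (∀ y : Fin n → ℝ, (∀ j, y j = 0 ∨ y j = 1) →
        Q y - P * ((∑ i, y i) - m) ^ 2 ≤ Q x - P * ((∑ i, x i) - m) ^ 2) →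
      (∑ i, x i) = m := by
    intro x hx hmax
    by_contra hne
    have h1 := hkey x z hx hz hne
    have h2 := hmax z hz
    rw [hfe z hzm] at h2
    linarith
  refine ⟨hone, fun v => ⟨?_, ?_⟩⟩
  · rintro ⟨⟨x, hx, rfl⟩, hub⟩
    have hxm := hone x hx fun y hy => hub ⟨y, hy, rfl⟩
    refine ⟨⟨x, ⟨hx, hxm⟩, (hfe x hxm).symm⟩, ?_⟩
    rintro _ ⟨y, ⟨hy, hym⟩, rfl⟩
    have := hub ⟨y, hy, rfl⟩
    simp only [hfe y hym] at this
    exact this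
  · rintro ⟨⟨x, ⟨hx, hxm⟩, rfl⟩, hub⟩
    refine ⟨⟨x, hx, hfe x hxm⟩, ?_⟩
    rintro _ ⟨y, hy, rfl⟩
    by_cases hym : (∑ i, y i) = m
    · have := hub ⟨y, ⟨hy, hym⟩, rfl⟩
      simp only [hfe y hym]
      exact this
    · exact (hkey y x hy hx hym).le
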